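/- Let U = [[A_U, B_U],[C_U, D_U]] and V = [[A_V, B_V],[C_V, D_V]] be complex block matrices with blocks of matching sizes, and let G_U = A_U − B_U D_U⁺ C_U and G_V = A_V − B_V D_V⁺ C_V be the complementary pseudo Schur complements. Suppose R(C_U) ⊆ R(D_U), R((D_U⁺ C_U)ᴴ) ⊆ R(G_Uᴴ), R(B_Vᴴ) ⊆ R(D_Vᴴ) and R(B_V D_V⁺) ⊆ R(G_V). If (U, V) is a Moore-Penrose inverse absorbing pair, then (G_U, G_V) is also a Moore-Penrose inverse absorbing pair. -/

import Mathlib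

open Matrix

/-- `X` is the Moore-Penrose inverse of `A`. -/
def IsMoorePenrose {m n : Type*} [Fintype m] [Fintype n]
    (A : Matrix m n ℂ) (X : Matrix n m ℂ) : Prop :=
  A * X * A = A ∧ X * A * X = X ∧ (A * X)ᴴ = A * X ∧ (X * A)ᴴ = X * A

/-- The column space (range) of a complex matrix. -/
noncomputable def colSpace {m n : Type*} [Fintype n] (A : Matrix m n ℂ) :
    Submodule ℂ (m → ℂ) :=
  LinearMap.range A.mulVecLin

theorem mul_mul_eq_of_colSpace_le {m n k : Type*} [Fintype m] [Fintype n] [Fintype k]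
    {C : Matrix m k ℂ} {D : Matrix m n ℂ} {X : Matrix n m ℂ}
    (hD : D * X * D = D) (h : colSpace C ≤ colSpace D) : D * X * C = C := by
  apply Matrix.mulVec_injective
  funext v
  obtain ⟨w, hw⟩ := h ⟨v, rfl⟩
  simp only [Matrix.mulVecLin_apply] at hw
  rw [← Matrix.mulVec_mulVec, ← hw, Matrix.mulVec_mulVec, hD]

theorem mul_mul_eq_of_colSpace_conjTranspose_le {m n k : Type*}
    [Fintype m] [Fintype n] [Fintype k]
    {B : Matrix k n ℂ} {D : Matrix m n ℂ} {X : Matrix n m ℂ}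
    (hD : D * X * D = D) (h : colSpace Bᴴ ≤ colSpace Dᴴ) : B * X * D = B := by
  have hD' : Dᴴ * Xᴴ * Dᴴ = Dᴴ := by
    simpa [Matrix.mul_assoc] using congrArg conjTranspose hD
  simpa [Matrix.mul_assoc] using congrArg conjTranspose (mul_mul_eq_of_colSpace_le hD' h)

/-- For a pair of matrices with Moore-Penrose inverses `X` and `Y`, being absorbing amounts to
the inclusions of the range of `A` in that of `B` and of the row space of `B` in that of `A`. -/
theorem IsMoorePenrose.add_eq_mul_add_mul_iff {m n : Type*} [Fintype m] [Fintype n]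
    {A B : Matrix m n ℂ} {X Y : Matrix n m ℂ}
    (hA : IsMoorePenrose A X) (hB : IsMoorePenrose B Y) :
    X + Y = X * (A + B) * Y ↔ B * Y * A = A ∧ B * X * A = B := by
  obtain ⟨a1, a2, a3, a4⟩ := hA
  obtain ⟨b1, b2, b3, b4⟩ := hB
  constructor
  · intro h
    have hX : X = X * (B * Y) := by
      have := congrArg (X * A * ·) h
      simp only [Matrix.mul_add, Matrix.add_mul, ← Matrix.mul_assoc, a2] at this
      rw [add_comm] at this
      simpa only [Matrix.mul_assoc] using add_left_cancel this
    have hY : Y = X * A * Y := by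
      rw [Matrix.mul_add, Matrix.add_mul, Matrix.mul_assoc X B, ← hX, add_comm] at h
      exact add_right_cancel h
    constructor
    · have h1 : A * X = B * Y * (A * X) := by
        have : A * X = A * X * (B * Y) := by rw [Matrix.mul_assoc, ← hX]
        simpa only [conjTranspose_mul (A * X), a3, b3] using congrArg conjTranspose this
      calc B * Y * A = B * Y * (A * X) * A := by
            rw [Matrix.mul_assoc (B * Y), a1]
        _ = A := by rw [← h1, a1]
    · have h1 : Y * B = Y * B * (X * A) := by
        have : Y * B = X * A * (Y * B) := by rw [← Matrix.mul_assoc, ← hY]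
        simpa only [conjTranspose_mul (X * A), a4, b4] using congrArg conjTranspose this
      calc B * X * A = B * (Y * B * (X * A)) := by
            simp only [← Matrix.mul_assoc, b1]
        _ = B := by rw [← h1, ← Matrix.mul_assoc, b1]
  · rintro ⟨h1, h2⟩
    have hX : X * B * Y = X := by
      have h3 : A * X * (B * Y) = A * X := by
        have : B * Y * (A * X) = A * X := by rw [← Matrix.mul_assoc, h1]
        simpa only [conjTranspose_mul (B * Y), a3, b3] using congrArg conjTranspose this
      calc X * B * Y = X * (A * X * (B * Y)) := by
            simp only [← Matrix.mul_assoc, a2]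
        _ = X := by rw [h3, ← Matrix.mul_assoc, a2]
    have hY : X * A * Y = Y := by
      have h3 : X * A * (Y * B) = Y * B := by
        have : Y * B * (X * A) = Y * B := by
          rw [Matrix.mul_assoc, ← Matrix.mul_assoc B, h2]
        simpa only [conjTranspose_mul (Y * B), a4, b4] using congrArg conjTranspose this
      calc X * A * Y = X * A * (Y * B) * Y := by
            rw [Matrix.mul_assoc (X * A), b2]
        _ = Y := by rw [h3, b2]
    rw [Matrix.mul_add, Matrix.add_mul, hX, hY, add_comm]

theorem inheritance_comp_pseudo_schur_moore_penrose_absorbing {m n p s : ℕ}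
    (AU : Matrix (Fin m) (Fin n) ℂ) (BU : Matrix (Fin m) (Fin p) ℂ)
    (CU : Matrix (Fin s) (Fin n) ℂ) (DU : Matrix (Fin s) (Fin p) ℂ)
    (AV : Matrix (Fin m) (Fin n) ℂ) (BV : Matrix (Fin m) (Fin p) ℂ)
    (CV : Matrix (Fin s) (Fin n) ℂ) (DV : Matrix (Fin s) (Fin p) ℂ)
    (DUp DVp : Matrix (Fin p) (Fin s) ℂ)
    (hDU : IsMoorePenrose DU DUp) (hDV : IsMoorePenrose DV DVp)
    (GUp GVp : Matrix (Fin n) (Fin m) ℂ)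
    (hGU : IsMoorePenrose (AU - BU * DUp * CU) GUp)
    (hGV : IsMoorePenrose (AV - BV * DVp * CV) GVp)
    (Up Vp : Matrix (Fin n ⊕ Fin p) (Fin m ⊕ Fin s) ℂ)
    (hU : IsMoorePenrose (Matrix.fromBlocks AU BU CU DU) Up)
    (hV : IsMoorePenrose (Matrix.fromBlocks AV BV CV DV) Vp)
    (h1 : colSpace CU ≤ colSpace DU)
    (h2 : colSpace (DUp * CU)ᴴ ≤ colSpace (AU - BU * DUp * CU)ᴴ)
    (h3 : colSpace BVᴴ ≤ colSpace DVᴴ)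
    (h4 : colSpace (BV * DVp) ≤ colSpace (AV - BV * DVp * CV))
    (habs : Up + Vp =
      Up * (Matrix.fromBlocks AU BU CU DU + Matrix.fromBlocks AV BV CV DV) * Vp) :
    GUp + GVp = GUp * ((AU - BU * DUp * CU) + (AV - BV * DVp * CV)) * GVp := by
  rw [hGU.add_eq_mul_add_mul_iff hGV]
  obtain ⟨hVU, hUV⟩ := (hU.add_eq_mul_add_mul_iff hV).1 habs
  have hC : DU * (DUp * CU) = CU := by
    rw [← Matrix.mul_assoc]
    exact mul_mul_eq_of_colSpace_le hDU.1 h1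
  have hB : BV * DVp * DV = BV := mul_mul_eq_of_colSpace_conjTranspose_le hDV.1 h3
  rw [Matrix.mul_assoc BU] at *
  generalize DUp * CU = E at *
  generalize BV * DVp = F at *
  set U := fromBlocks AU BU CU DU
  set V := fromBlocks AV BV CV DV
  set GU := AU - BU * E
  set GV := AV - F * CV
  let P : Matrix (Fin n ⊕ Fin p) (Fin n) ℂ := fromRows 1 (-E)
  let Q : Matrix (Fin m) (Fin m ⊕ Fin s) ℂ := fromCols 1 (-F)
  have hUP : U * P = fromRows GU 0 := by
    simp [U, P, GU, fromBlocks_mul_fromRows, hC, sub_eq_add_neg]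
  have hQV : Q * V = fromCols GV 0 := by
    simp [V, Q, GV, fromCols_mul_fromBlocks, hB, sub_eq_add_neg]
  have hQUP : Q * U * P = GU := by
    rw [Matrix.mul_assoc, hUP]
    simp [Q, fromCols_mul_fromRows]
  have hQVP : Q * V * P = GV := by
    rw [hQV]
    simp [P, fromCols_mul_fromRows]
  obtain ⟨W, hW⟩ : ∃ W : Matrix (Fin n) (Fin n) ℂ, GU = GV * W := by
    refine ⟨(Vp * U * P).toRows₁, ?_⟩
    calc GU = Q * V * (Vp * U * P) := by
          rw [← hQUP]
          nth_rw 1 [← hVU]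
          simp only [Matrix.mul_assoc]
      _ = _ := by
          rw [hQV, ← fromRows_toRows (Vp * U * P), fromCols_mul_fromRows]
          simp
  obtain ⟨Z, hZ⟩ : ∃ Z : Matrix (Fin m) (Fin m) ℂ, GV = Z * GU := by
    refine ⟨(Q * V * Up).toCols₁, ?_⟩
    calc GV = Q * V * Up * (U * P) := by
          rw [← hQVP]
          nth_rw 1 [← hUV]
          simp only [Matrix.mul_assoc]
      _ = _ := by
          rw [hUP, ← fromCols_toCols (Q * V * Up), fromCols_mul_fromRows]
          simp
  constructor
  · rw [hW, ← Matrix.mul_assoc, hGV.1]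
  · calc GV * GUp * GU = Z * (GU * GUp * GU) := by
          rw [hZ]
          simp only [Matrix.mul_assoc]
      _ = GV := by rw [hGU.1, ← hZ]
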